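/- arXiv:2204.07378 — 2 statements merged into one kernel-verified Lean document; each statement's English description precedes it below -/
import Mathlib

section
/- For any two subsets S₁ and S₂ of the customer set {1,…,n} with S₁ ⊆ S₂, the expected traveled distance satisfies L(S₁) ≤ L(S₂). -/
open Finset

/-- Expected revenue of a set of customers. -/
def R (pi p : ℕ → ℝ) (S : Finset ℕ) : ℝ := ∑ i ∈ S, pi i * p i

/-- Expected traveled distance (with l i = 2 * x i). -/
def L (x pi : ℕ → ℝ) (S : Finset ℕ) : ℝ :=
  ∑ i ∈ S, (2 * x i) * pi i * ∏ j ∈ S.filter (fun j => i < j), (1 - pi j)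

/-- Expected profit at unitary cost c. -/
def G (x pi p : ℕ → ℝ) (S : Finset ℕ) (c : ℝ) : ℝ := R pi p S - c * L x pi S

/-- Optimal value of the probabilistic profitable tour problem on a line. -/
def PPTP (n : ℕ) (x pi p : ℕ → ℝ) (c : ℝ) : ℝ :=
  (Finset.Icc 1 n).powerset.sup' (Finset.powerset_nonempty _) (fun S => G x pi p S c)

/-- Adding a customer beyond all those of `S` makes the distance a convex combination of the
round trip to the new customer and the distance of `S`. -/
theorem L_insert_of_forall_lt (x pi : ℕ → ℝ) {m : ℕ} {S : Finset ℕ} (hm : ∀ i ∈ S, i < m) :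
    L x pi (insert m S) = 2 * x m * pi m + (1 - pi m) * L x pi S := by
  have hmS : m ∉ S := fun h => lt_irrefl m (hm m h)
  unfold L
  rw [Finset.sum_insert hmS, Finset.mul_sum]
  congr 1
  · have h_empty : (insert m S).filter (fun j => m < j) = ∅ := by
      ext j
      simp only [Finset.mem_filter, Finset.mem_insert, Finset.notMem_empty, iff_false]
      rintro ⟨rfl | hj, hlt⟩
      · exact lt_irrefl _ hlt
      · exact lt_asymm hlt (hm j hj)
    rw [h_empty, Finset.prod_empty, mul_one]
  · refine Finset.sum_congr rfl fun i hi => ?_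
    rw [Finset.filter_insert, if_pos (hm i hi), Finset.prod_insert (by simp [hmS])]
    ring

/-- The expected distance is at most the round trip to any point beyond all customers of `S`. -/
theorem L_le_two_mul (x pi : ℕ → ℝ) {M : ℝ} (hM : 0 ≤ M) (S : Finset ℕ)
    (hpi : ∀ i ∈ S, 0 ≤ pi i ∧ pi i ≤ 1) (hx : ∀ i ∈ S, x i ≤ M) :
    L x pi S ≤ 2 * M := by
  induction S using Finset.induction_on_max with
  | empty => simpa [L] using hM
  | insert m S hm ih =>
    rw [L_insert_of_forall_lt x pi hm]
    have hS := ih (fun i hi => hpi i (Finset.mem_insert_of_mem hi))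
      (fun i hi => hx i (Finset.mem_insert_of_mem hi))
    obtain ⟨hpi₀, hpi₁⟩ := hpi m (Finset.mem_insert_self m S)
    have hxm := hx m (Finset.mem_insert_self m S)
    nlinarith [mul_le_mul_of_nonneg_left hxm hpi₀,
      mul_le_mul_of_nonneg_left hS (sub_nonneg.2 hpi₁)]

/-- The expected distance is monotone when positions are nonnegative and nondecreasing. -/
theorem L_mono (x pi : ℕ → ℝ) {S T : Finset ℕ} (hST : S ⊆ T)
    (hpi : ∀ i ∈ T, 0 ≤ pi i ∧ pi i ≤ 1) (hx : ∀ i ∈ T, 0 ≤ x i)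
    (hxmono : MonotoneOn x T) :
    L x pi S ≤ L x pi T := by
  induction T using Finset.induction_on_max generalizing S with
  | empty => rw [Finset.subset_empty.1 hST]
  | insert m T hm ih =>
    have hmT := Finset.mem_insert_self m T
    have hT : T ⊆ insert m T := Finset.subset_insert m T
    obtain ⟨hpi₀, hpi₁⟩ := hpi m hmT
    have ih' : ∀ {U : Finset ℕ}, U ⊆ T → L x pi U ≤ L x pi T := fun hU =>
      ih hU (fun i hi => hpi i (hT hi)) (fun i hi => hx i (hT hi))
        (hxmono.mono (Finset.coe_subset.2 hT))
    rw [L_insert_of_forall_lt x pi hm]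
    by_cases hmS : m ∈ S
    · have hsub : S.erase m ⊆ T := Finset.subset_insert_iff.1 hST
      rw [← Finset.insert_erase hmS,
        L_insert_of_forall_lt x pi (fun i hi => hm i (hsub hi))]
      gcongr
      exact ih' hsub
    · have hle := ih' ((Finset.subset_insert_iff_of_notMem hmS).1 hST)
      have hbound : L x pi T ≤ 2 * x m :=
        L_le_two_mul x pi (hx m hmT) T (fun i hi => hpi i (hT hi)) fun i hi =>
          hxmono (Finset.mem_coe.2 (hT hi)) (Finset.mem_coe.2 hmT) (hm i hi).le
      nlinarith [mul_le_mul_of_nonneg_left hbound hpi₀]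

theorem stmt3 (n : ℕ) (x p pi : ℕ → ℝ)
    (hx : ∀ i ∈ Finset.Icc 1 n, 0 < x i)
    (hxmono : ∀ i, 1 ≤ i → i + 1 ≤ n → x i ≤ x (i + 1))
    (hp : ∀ i ∈ Finset.Icc 1 n, 0 < p i)
    (hpi : ∀ i ∈ Finset.Icc 1 n, 0 < pi i ∧ pi i ≤ 1)
    (S₁ S₂ : Finset ℕ) (hS₁ : S₁ ⊆ Finset.Icc 1 n) (hS₂ : S₂ ⊆ Finset.Icc 1 n)
    (h₁₂ : S₁ ⊆ S₂) :
    L x pi S₁ ≤ L x pi S₂ := by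
  refine L_mono x pi h₁₂ (fun i hi => ⟨(hpi i (hS₂ hi)).1.le, (hpi i (hS₂ hi)).2⟩)
    (fun i hi => (hx i (hS₂ hi)).le) fun i hi j hj hij => ?_
  have hi₁ := (Finset.mem_Icc.1 (hS₂ hi)).1
  have hjn := (Finset.mem_Icc.1 (hS₂ hj)).2
  clear hi hj
  induction j, hij using Nat.le_induction with
  | base => exact le_rfl
  | succ k hik ih => exact (ih (by omega)).trans (hxmono k (by omega) hjn)
end

section
/- If 0 ≤ c₁ < c₂ and the function c ↦ PPTP(c) is affine on the open interval (c₁,c₂) (i.e., there exist α, β ∈ ℝ with PPTP(c) = α + β·c for all c ∈ (c₁,c₂)), then there is exactly one subset S of {1,…,n} that is optimal at some c ∈ (c₁,c₂); this S is the unique optimal set at every c ∈ (c₁,c₂). -/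
open Finset

/-- Adding a new farthest customer `a` replaces the distance by a convex combination. -/
theorem L_insert_of_lt (x pi : ℕ → ℝ) {a : ℕ} {S : Finset ℕ} (h : ∀ i ∈ S, i < a) :
    L x pi (insert a S) = 2 * x a * pi a + (1 - pi a) * L x pi S := by
  have ha : a ∉ S := fun h' => lt_irrefl a (h a h')
  have hempty : (insert a S).filter (fun j => a < j) = ∅ := by
    rw [Finset.filter_eq_empty_iff]
    intro j hj
    rcases Finset.mem_insert.1 hj with rfl | hj
    · exact lt_irrefl _
    · exact (h j hj).le.not_gt
  unfold L
  rw [Finset.sum_insert ha, hempty, Finset.prod_empty, mul_one, Finset.mul_sum]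
  congr 1
  refine Finset.sum_congr rfl fun i hi => ?_
  rw [Finset.filter_insert, if_pos (h i hi), Finset.prod_insert (by simp [ha])]
  ring

theorem L_eq_erase_add (x pi : ℕ → ℝ) {a : ℕ} {S : Finset ℕ} (h : ∀ i ∈ S.erase a, i < a) :
    L x pi S = L x pi (S.erase a) +
      if a ∈ S then pi a * (2 * x a - L x pi (S.erase a)) else 0 := by
  split_ifs with ha
  · conv_lhs => rw [← Finset.insert_erase ha, L_insert_of_lt x pi h]
    ring
  · rw [Finset.erase_eq_of_notMem ha, add_zero]

theorem L_le_of_forall_le {x pi : ℕ → ℝ} {b : ℝ} (hb : 0 ≤ b) {S : Finset ℕ}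
    (hx : ∀ i ∈ S, x i ≤ b) (hpi : ∀ i ∈ S, 0 ≤ pi i ∧ pi i ≤ 1) : L x pi S ≤ 2 * b := by
  induction S using Finset.induction_on_max with
  | empty => simpa [L] using hb
  | insert a S h ih =>
    rw [L_insert_of_lt x pi h]
    have hS := ih (fun i hi => hx i (Finset.mem_insert_of_mem hi))
      (fun i hi => hpi i (Finset.mem_insert_of_mem hi))
    have hxa := hx a (Finset.mem_insert_self a S)
    obtain ⟨h0, h1⟩ := hpi a (Finset.mem_insert_self a S)
    nlinarith [mul_le_mul_of_nonneg_left hxa h0, mul_le_mul_of_nonneg_left hS (sub_nonneg.2 h1)]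

/-- The expected traveled distance is monotone and submodular. -/
theorem L_mono_and_submodular {x pi : ℕ → ℝ} {U : Finset ℕ} (hx : ∀ i ∈ U, 0 ≤ x i)
    (hmono : MonotoneOn x (U : Set ℕ)) (hpi : ∀ i ∈ U, 0 ≤ pi i ∧ pi i ≤ 1) :
    (∀ S T, S ⊆ T → T ⊆ U → L x pi S ≤ L x pi T) ∧
      ∀ S T, S ⊆ U → T ⊆ U →
        L x pi (S ∪ T) + L x pi (S ∩ T) ≤ L x pi S + L x pi T := by
  induction U using Finset.induction_on_max with
  | empty =>
    refine ⟨fun S T hST hT => ?_, fun S T hS hT => ?_⟩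
    · rw [Finset.subset_empty.1 hT] at hST ⊢
      rw [Finset.subset_empty.1 hST]
    · simp [Finset.subset_empty.1 hS, Finset.subset_empty.1 hT]
  | insert a U h ih =>
    obtain ⟨ihm, ihs⟩ := ih (fun i hi => hx i (Finset.mem_insert_of_mem hi))
      (hmono.mono (by simp)) (fun i hi => hpi i (Finset.mem_insert_of_mem hi))
    have haU := Finset.mem_insert_self a U
    obtain ⟨h0, h1⟩ := hpi a haU
    have hsub : ∀ S, S ⊆ insert a U → S.erase a ⊆ U := fun S hS =>
      Finset.subset_insert_iff.1 hS
    have hrec : ∀ S, S ⊆ insert a U → L x pi S = L x pi (S.erase a) +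
        if a ∈ S then pi a * (2 * x a - L x pi (S.erase a)) else 0 := fun S hS =>
      L_eq_erase_add x pi fun i hi => h i (hsub S hS hi)
    have hle : ∀ S, S ⊆ insert a U → L x pi (S.erase a) ≤ 2 * x a := fun S hS =>
      L_le_of_forall_le (hx a haU)
        (fun i hi => hmono (Finset.mem_insert_of_mem (hsub S hS hi)) haU
          (h i (hsub S hS hi)).le)
        (fun i hi => hpi i (Finset.mem_insert_of_mem (hsub S hS hi)))
    refine ⟨fun S T hST hT => ?_, fun S T hS hT => ?_⟩
    · have hS := hST.trans hT
      have hm := ihm _ _ (Finset.erase_subset_erase a hST) (hsub T hT)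
      have h2 := hle S hS
      have h3 := hle T hT
      rw [hrec S hS, hrec T hT]
      by_cases haS : a ∈ S
      · simp only [haS, hST haS, if_true]
        nlinarith
      · by_cases haT : a ∈ T
        · simp only [haS, haT, if_true, if_false]
          nlinarith
        · simpa [haS, haT] using hm
    · have hs := ihs _ _ (hsub S hS) (hsub T hT)
      have hmS := ihm _ _ (Finset.inter_subset_left (s₁ := S.erase a) (s₂ := T.erase a))
        (hsub S hS)
      have hmT := ihm _ _ (Finset.inter_subset_right (s₁ := S.erase a) (s₂ := T.erase a))
        (hsub T hT)
      rw [hrec S hS, hrec T hT, hrec _ (Finset.union_subset hS hT),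
        hrec _ (Finset.inter_subset_left.trans hS), Finset.erase_union_distrib,
        show (S ∩ T).erase a = S.erase a ∩ T.erase a by
          rw [Finset.erase_inter, Finset.inter_erase, Finset.erase_idem]]
      by_cases haS : a ∈ S <;> by_cases haT : a ∈ T <;>
        simp only [haS, haT, Finset.mem_union, Finset.mem_inter, or_self, or_true,
          or_false, and_self, and_true, and_false, if_true, if_false]
      · nlinarith
      · nlinarith
      · nlinarith
      · linarith

theorem monotoneOn_Icc_one {n : ℕ} {x : ℕ → ℝ}
    (h : ∀ i, 1 ≤ i → i + 1 ≤ n → x i ≤ x (i + 1)) :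
    MonotoneOn x (Finset.Icc 1 n : Set ℕ) := by
  intro i hi j hj hij
  have hi1 := (Finset.mem_Icc.1 hi).1
  have hjn := (Finset.mem_Icc.1 hj).2
  clear hj
  induction j, hij using Nat.le_induction with
  | base => exact le_rfl
  | succ k hik ih => exact (ih (by omega)).trans (h k (hi1.trans hik) hjn)

theorem R_strictMono {pi p : ℕ → ℝ} {S T : Finset ℕ} (hST : S ⊂ T)
    (hpos : ∀ i ∈ T, 0 < pi i * p i) : R pi p S < R pi p T := by
  obtain ⟨i, hiT, hiS⟩ := Finset.exists_of_ssubset hST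
  exact Finset.sum_lt_sum_of_subset hST.1 hiT hiS (hpos i hiT) fun j hj _ => (hpos j hj).le

theorem G_le_PPTP {n : ℕ} (x pi p : ℕ → ℝ) {S : Finset ℕ} (hS : S ⊆ Finset.Icc 1 n) (c : ℝ) :
    G x pi p S c ≤ PPTP n x pi p c :=
  Finset.le_sup' (fun S => G x pi p S c) (Finset.mem_powerset.2 hS)

theorem exists_G_eq_PPTP (n : ℕ) (x pi p : ℕ → ℝ) (c : ℝ) :
    ∃ S ⊆ Finset.Icc 1 n, G x pi p S c = PPTP n x pi p c := by
  obtain ⟨S, hS, h⟩ := Finset.exists_mem_eq_sup' (Finset.powerset_nonempty (Finset.Icc 1 n))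
    (fun S => G x pi p S c)
  exact ⟨S, Finset.mem_powerset.1 hS, h.symm⟩

/-- An affine function below another one on an open interval, touching it there, equals it. -/
theorem affine_eq_of_le_of_touch {a b a' b' c₁ c₂ c : ℝ} (hc : c ∈ Set.Ioo c₁ c₂)
    (hle : ∀ d ∈ Set.Ioo c₁ c₂, a + b * d ≤ a' + b' * d) (heq : a + b * c = a' + b' * c) :
    a = a' ∧ b = b' := by
  obtain ⟨h1, h2⟩ := hc
  have hl := hle ((c₁ + c) / 2) ⟨by linarith, by linarith⟩
  have hr := hle ((c + c₂) / 2) ⟨by linarith, by linarith⟩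
  have hb : b = b' := by
    apply le_antisymm
    · by_contra! hlt
      nlinarith [mul_pos (sub_pos.2 hlt) (sub_pos.2 h2)]
    · by_contra! hlt
      nlinarith [mul_pos (sub_pos.2 hlt) (sub_pos.2 h1)]
  subst hb
  exact ⟨by linarith, rfl⟩

theorem stmt17 (n : ℕ) (x p pi : ℕ → ℝ)
    (hx : ∀ i ∈ Finset.Icc 1 n, 0 < x i)
    (hxmono : ∀ i, 1 ≤ i → i + 1 ≤ n → x i ≤ x (i + 1))
    (hp : ∀ i ∈ Finset.Icc 1 n, 0 < p i)
    (hpi : ∀ i ∈ Finset.Icc 1 n, 0 < pi i ∧ pi i ≤ 1)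
    (c₁ c₂ : ℝ) (hc₁ : 0 ≤ c₁) (hlt : c₁ < c₂)
    (α β : ℝ) (haff : ∀ c ∈ Set.Ioo c₁ c₂, PPTP n x pi p c = α + β * c) :
    ∃ S : Finset ℕ, S ⊆ Finset.Icc 1 n ∧
      (∀ c ∈ Set.Ioo c₁ c₂, G x pi p S c = PPTP n x pi p c) ∧
      ∀ T : Finset ℕ, T ⊆ Finset.Icc 1 n →
        (∃ c ∈ Set.Ioo c₁ c₂, G x pi p T c = PPTP n x pi p c) → T = S := by
  have hopt : ∀ T ⊆ Finset.Icc 1 n, ∀ c ∈ Set.Ioo c₁ c₂,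
      G x pi p T c = PPTP n x pi p c → R pi p T = α ∧ -L x pi T = β := by
    intro T hT c hc h
    refine affine_eq_of_le_of_touch hc (fun d hd => ?_) ?_
    · have := G_le_PPTP x pi p hT d
      rw [haff d hd] at this
      unfold G at this
      linarith
    · rw [haff c hc] at h
      unfold G at h
      linarith
  obtain ⟨-, hsub⟩ := L_mono_and_submodular (fun i hi => (hx i hi).le)
    (monotoneOn_Icc_one hxmono) (fun i hi => ⟨(hpi i hi).1.le, (hpi i hi).2⟩)
  have hpos : ∀ i ∈ Finset.Icc 1 n, 0 < pi i * p i := fun i hi =>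
    mul_pos (hpi i hi).1 (hp i hi)
  have hm : (c₁ + c₂) / 2 ∈ Set.Ioo c₁ c₂ := ⟨by linarith, by linarith⟩
  obtain ⟨S, hS, hSm⟩ := exists_G_eq_PPTP n x pi p ((c₁ + c₂) / 2)
  obtain ⟨hRS, hLS⟩ := hopt S hS _ hm hSm
  refine ⟨S, hS, fun c hc => ?_, ?_⟩
  · rw [haff c hc, G, hRS, ← hLS]
    ring
  rintro T hT ⟨c, hc, hTc⟩
  obtain ⟨hRT, hLT⟩ := hopt T hT c hc hTc
  have hinter : S ∩ T ⊆ Finset.Icc 1 n := Finset.inter_subset_left.trans hS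
  have hR : R pi p (S ∪ T) + R pi p (S ∩ T) = R pi p S + R pi p T := Finset.sum_union_inter
  have hL := mul_le_mul_of_nonneg_left (hsub S T hS hT) (hc₁.trans hc.1.le)
  have hRI : R pi p (S ∩ T) = α := by
    refine (hopt _ hinter c hc (le_antisymm (G_le_PPTP x pi p hinter c) ?_)).1
    have hU := G_le_PPTP x pi p (Finset.union_subset hS hT) c
    rw [haff c hc] at hU ⊢
    unfold G at hU ⊢
    rw [← hLT] at hU ⊢
    rw [show L x pi S = L x pi T by linarith] at hL
    linarith
  have heq : ∀ V ⊆ Finset.Icc 1 n, R pi p V = α → S ∩ T ⊆ V → S ∩ T = V := by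
    intro V hV hRV hIV
    by_contra hne
    have := R_strictMono (Finset.ssubset_iff_subset_ne.2 ⟨hIV, hne⟩)
      fun i hi => hpos i (hV hi)
    linarith
  exact (heq T hT hRT Finset.inter_subset_right).symm.trans
    (heq S hS hRS Finset.inter_subset_left)
end
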